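/- The series Σ_{j=0}^∞ a_j²·ω_{j+1} converges and its sum is strictly less than S₂ + 5·a₂₅²·ω₂₆. (Inequality (4.5) of Proposition 3.3: an upper bound for ‖zF‖²_ω.) -/

import Mathlib

open Finset

/-- The weights `ω_k = (2k choose k)/4^k`. -/
noncomputable def ω : ℕ → ℝ :=
  fun k => (Nat.choose (2 * k) k : ℝ) / 4 ^ k

/-- Maclaurin coefficients of `F(z) = (1 - √(2/3) z)^(-5/2)`. -/
noncomputable def a : ℕ → ℝ :=
  fun j => ∏ t ∈ Finset.Icc 1 j, (Real.sqrt (2 / 3) * (1 + 3 / (2 * (t : ℝ))))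

noncomputable def S₁ : ℝ :=
  Real.sqrt (2 / 3) * ∑ j ∈ Finset.range 25, (1 + 3 / (2 * ((j : ℝ) + 1))) * (a j) ^ 2 * ω (j + 1)

noncomputable def S₂ : ℝ :=
  ∑ j ∈ Finset.range 25, (a j) ^ 2 * ω (j + 1)

noncomputable def S₃ : ℝ :=
  (5 - Real.sqrt 6) * (a 25) ^ 2 * ω 26

noncomputable def S₄ : ℝ :=
  ∑ j ∈ Finset.range 25, (a j) ^ 2 * ω (j + 1) / ((j : ℝ) + 1)

lemma omega_pos (k : ℕ) : 0 < ω k := by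
  unfold ω
  have : 0 < Nat.choose (2 * k) k := Nat.choose_pos (by omega)
  positivity

lemma omega_succ (k : ℕ) : ω (k + 1) = ω k * ((2 * k + 1) / (2 * k + 2)) := by
  have h := Nat.succ_mul_centralBinom_succ k
  unfold Nat.centralBinom at h
  have h' : ((k : ℝ) + 1) * (Nat.choose (2 * (k + 1)) (k + 1) : ℝ)
      = 2 * (2 * k + 1) * (Nat.choose (2 * k) k : ℝ) := by exact_mod_cast h
  unfold ω
  have hk : (k : ℝ) + 1 ≠ 0 := by positivity
  have h2 : (Nat.choose (2 * (k + 1)) (k + 1) : ℝ)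
      = 2 * (2 * k + 1) * (Nat.choose (2 * k) k : ℝ) / ((k : ℝ) + 1) := by
    rw [eq_div_iff hk]; linarith
  have hk2 : 2 * (k : ℝ) + 2 ≠ 0 := by positivity
  rw [h2, pow_succ]
  field_simp
  ring

lemma a_succ (j : ℕ) :
    a (j + 1) = a j * (Real.sqrt (2 / 3) * (1 + 3 / (2 * ((j : ℝ) + 1)))) := by
  unfold a
  rw [Finset.prod_Icc_succ_top (by omega)]
  push_cast
  rfl

lemma a_pos (j : ℕ) : 0 < a j := by
  unfold a
  exact Finset.prod_pos fun t _ => by positivity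

lemma term_pos (j : ℕ) : 0 < (a j) ^ 2 * ω (j + 1) :=
  mul_pos (pow_pos (a_pos j) 2) (omega_pos _)

lemma term_ratio (j : ℕ) (hj : 25 ≤ j) :
    (a (j + 1)) ^ 2 * ω (j + 1 + 1) ≤ 3 / 4 * ((a j) ^ 2 * ω (j + 1)) := by
  have hx : (25 : ℝ) ≤ j := by exact_mod_cast hj
  have hs : Real.sqrt (2 / 3) ^ 2 = 2 / 3 := Real.sq_sqrt (by norm_num)
  rw [a_succ, omega_succ (j + 1)]
  push_cast
  have key : 2 / 3 * (1 + 3 / (2 * ((j : ℝ) + 1))) ^ 2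
      * ((2 * ((j : ℝ) + 1) + 1) / (2 * ((j : ℝ) + 1) + 2)) ≤ 3 / 4 := by
    obtain ⟨y, hy⟩ : ∃ y : ℝ, (j : ℝ) = y + 25 := ⟨j - 25, by ring⟩
    have hy0 : 0 ≤ y := by linarith
    rw [hy]
    have e : 1 + 3 / (2 * (y + 25 + 1)) = (2 * y + 55) / (2 * (y + 26)) := by
      field_simp
      ring
    rw [e, div_pow, div_mul_div_comm, div_mul_div_comm, div_le_div_iff₀ (by positivity) (by norm_num)]
    nlinarith [pow_nonneg hy0 2, pow_nonneg hy0 3]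
  calc _ = (Real.sqrt (2 / 3) ^ 2 * (1 + 3 / (2 * ((j : ℝ) + 1))) ^ 2
      * ((2 * ((j : ℝ) + 1) + 1) / (2 * ((j : ℝ) + 1) + 2))) * ((a j) ^ 2 * ω (j + 1)) := by ring
    _ ≤ _ := by
      rw [hs]
      exact mul_le_mul_of_nonneg_right key (term_pos j).le

lemma term_geom (i : ℕ) :
    (a (i + 25)) ^ 2 * ω (i + 25 + 1) ≤ (a 25) ^ 2 * ω 26 * (3 / 4) ^ i := by
  induction i with
  | zero => simp
  | succ i ih =>
    have h := term_ratio (i + 25) (by omega)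
    rw [show i + 1 + 25 = i + 25 + 1 by ring, pow_succ (3 / 4 : ℝ) i]
    linarith

/-- Inequality (4.5): `‖zF‖²_ω < S₂ + 5 a₂₅² ω₂₆`. -/
theorem norm_squared_upper_bound :
    Summable (fun j : ℕ => (a j) ^ 2 * ω (j + 1)) ∧
    (∑' j : ℕ, (a j) ^ 2 * ω (j + 1)) < S₂ + 5 * (a 25) ^ 2 * ω 26 := by
  have hg : Summable (fun i : ℕ => (a 25) ^ 2 * ω 26 * (3 / 4 : ℝ) ^ i) :=
    (summable_geometric_of_lt_one (by norm_num) (by norm_num)).mul_left _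
  have ht : Summable (fun i : ℕ => (a (i + 25)) ^ 2 * ω (i + 25 + 1)) :=
    Summable.of_nonneg_of_le (fun i => (term_pos _).le) term_geom hg
  have hs : Summable (fun j : ℕ => (a j) ^ 2 * ω (j + 1)) :=
    (summable_nat_add_iff (f := fun j : ℕ => (a j) ^ 2 * ω (j + 1)) 25).1 ht
  refine ⟨hs, ?_⟩
  have h1 := hs.sum_add_tsum_nat_add 25
  have h2 := ht.tsum_le_tsum term_geom hg
  rw [tsum_mul_left, tsum_geometric_of_lt_one (by norm_num) (by norm_num)] at h2
  have h3 := term_pos 25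
  norm_num at h2 h3
  unfold S₂
  rw [← h1]
  linarith
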